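/- Let G be a group, k a field, kG the group Hopf algebra with basis {δ_g}_{g∈G}, and let C be a symmetric left partial kG-module coalgebra. For g ∈ G define P_g: C → C by P_g(c) = ε(δ_{g⁻¹}·c₍₁₎)c₍₂₎ and θ_g: C → C by θ_g(c) = δ_g·P_{g⁻¹}(c). Then for all g, h ∈ G: (a) θ_e = id_C; (b) θ_{h⁻¹}∘P_{g⁻¹}∘P_h = P_{(gh)⁻¹}∘θ_{h⁻¹}∘P_h; (c) θ_g∘θ_h∘P_{h⁻¹}∘P_{(gh)⁻¹} = θ_{gh}∘P_{h⁻¹}∘P_{(gh)⁻¹}. -/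

import Mathlib

open TensorProduct

/-- `sw4 k f₁ f₂ h c = ∑ f₁(h₍₁₎ ⊗ c₍₁₎) ⊗ f₂(h₍₂₎ ⊗ c₍₂₎)` in Sweedler notation. -/
noncomputable def sw4 (k : Type*) [Field k] {H C M N : Type*}
    [AddCommGroup H] [Module k H] [Coalgebra k H]
    [AddCommGroup C] [Module k C] [Coalgebra k C]
    [AddCommGroup M] [Module k M] [AddCommGroup N] [Module k N]
    (f₁ : H ⊗[k] C →ₗ[k] M) (f₂ : H ⊗[k] C →ₗ[k] N) (h : H) (c : C) : M ⊗[k] N :=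
  (TensorProduct.map f₁ f₂)
    ((TensorProduct.tensorTensorTensorComm k H H C C)
      ((Coalgebra.comul (R := k) h) ⊗ₜ[k] (Coalgebra.comul (R := k) c)))
/-- A left partial `H`-module coalgebra: (PLHMC1) `Δ(h·c) = ∑ (h₍₁₎·c₍₁₎) ⊗ (h₍₂₎·c₍₂₎)`;
(PLHMC2) `1·c = c`; (PLHMC3) `h·(g·c) = ∑ (hg₍₁₎·c₍₁₎) ε(g₍₂₎·c₍₂₎)`. -/
structure IsPartialModuleCoalgebra (k : Type*) [Field k] {H C : Type*} [Ring H] [Bialgebra k H]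
    [AddCommGroup C] [Module k C] [Coalgebra k C] (act : H →ₗ[k] C →ₗ[k] C) : Prop where
  plhmc1 : ∀ (h : H) (c : C), Coalgebra.comul (R := k) (act h c) =
    sw4 k (TensorProduct.lift act) (TensorProduct.lift act) h c
  plhmc2 : ∀ c : C, act 1 c = c
  plhmc3 : ∀ (h g : H) (c : C), act h (act g c) =
    (TensorProduct.rid k C) (sw4 k
      (TensorProduct.lift act ∘ₗ TensorProduct.map (LinearMap.mulLeft k h) LinearMap.id)
      (Coalgebra.counit ∘ₗ TensorProduct.lift act) g c)
/-- A symmetric left partial `H`-module coalgebra: a left partial `H`-module coalgebra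
which moreover satisfies (PLHMC3') `h·(g·c) = ∑ ε(g₍₁₎·c₍₁₎) (hg₍₂₎·c₍₂₎)`. -/
structure IsSymmPartialModuleCoalgebra (k : Type*) [Field k] {H C : Type*}
    [Ring H] [Bialgebra k H] [AddCommGroup C] [Module k C] [Coalgebra k C]
    (act : H →ₗ[k] C →ₗ[k] C) extends IsPartialModuleCoalgebra k act : Prop where
  plhmc3' : ∀ (h g : H) (c : C), act h (act g c) =
    (TensorProduct.lid k C) (sw4 k
      (Coalgebra.counit ∘ₗ TensorProduct.lift act)
      (TensorProduct.lift act ∘ₗ TensorProduct.map (LinearMap.mulLeft k h) LinearMap.id) g c)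
/-- The projection `P(c) = ∑ ε(u·c₍₁₎)c₍₂₎` associated to an element `u` of `H` acting on `C`. -/
noncomputable def Pmap (k : Type*) [Field k] {H C : Type*}
    [AddCommGroup H] [Module k H]
    [AddCommGroup C] [Module k C] [Coalgebra k C]
    (act : H →ₗ[k] C →ₗ[k] C) (u : H) : C →ₗ[k] C :=
  (TensorProduct.lid k C).toLinearMap ∘ₗ
    TensorProduct.map (Coalgebra.counit ∘ₗ act u) LinearMap.id ∘ₗ Coalgebra.comul

/-- If `Δ(v) = v ⊗ v`, symmetry of the partial action reads `u·(v·c) = uv·P(c)`, where `P` is the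
projection associated to `v`. -/
theorem IsSymmPartialModuleCoalgebra.act_act_of_comul_eq {k H C : Type*} [Field k]
    [Ring H] [Bialgebra k H] [AddCommGroup C] [Module k C] [Coalgebra k C]
    {act : H →ₗ[k] C →ₗ[k] C} (hact : IsSymmPartialModuleCoalgebra k act)
    (u : H) {v : H} (hv : Coalgebra.comul (R := k) v = v ⊗ₜ[k] v) (c : C) :
    act u (act v c) = act (u * v) (Pmap k act v c) := by
  rw [hact.plhmc3', sw4, hv]
  simp only [Pmap, LinearMap.comp_apply]
  induction Coalgebra.comul (R := k) c using TensorProduct.induction_on with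
  | zero => simp
  | tmul x y => simp
  | add x y hx hy =>
    simp only [TensorProduct.tmul_add, map_add] at hx hy ⊢
    rw [hx, hy]

/-- Let `H = kG` be the group Hopf algebra of a group `G`, with basis `{δ_g}` of grouplike
elements, and let `C` be a symmetric left partial `kG`-module coalgebra. With
`P_g := Pmap k act (δ g⁻¹)` (so `P_g(c) = ∑ ε(δ_{g⁻¹}·c₍₁₎)c₍₂₎`) and
`θ_g(c) := δ_g·P_{g⁻¹}(c)`, for all `g h ∈ G`:
(a) `θ_e = id_C`; (b) `θ_{h⁻¹}∘P_{g⁻¹}∘P_h = P_{(gh)⁻¹}∘θ_{h⁻¹}∘P_h`;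
(c) `θ_g∘θ_h∘P_{h⁻¹}∘P_{(gh)⁻¹} = θ_{gh}∘P_{h⁻¹}∘P_{(gh)⁻¹}`. -/
theorem groupAlgebra_partialModuleCoalgebra_theta
    {k G H C : Type*} [Field k] [Group G] [Ring H] [HopfAlgebra k H]
    [AddCommGroup C] [Module k C] [Coalgebra k C]
    -- `H` is the group algebra `kG` with basis `{δ_g}_{g ∈ G}`:
    (δ : G →* H)
    (hbasis : LinearIndependent k (fun g : G => δ g))
    (hspan : Submodule.span k (Set.range (fun g : G => δ g)) = ⊤)
    (hcomul : ∀ g : G, Coalgebra.comul (R := k) (δ g) = δ g ⊗ₜ[k] δ g)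
    (hcounit : ∀ g : G, Coalgebra.counit (R := k) (δ g) = 1)
    (hantipode : ∀ g : G, HopfAlgebra.antipode (R := k) (δ g) = δ g⁻¹)
    -- `C` is a symmetric left partial `kG`-module coalgebra:
    (act : H →ₗ[k] C →ₗ[k] C) (hact : IsSymmPartialModuleCoalgebra k act) :
    -- (a) `θ_e = id_C`  (here `θ_g = act (δ g) ∘ P_{g⁻¹}` and `P_{g⁻¹} = Pmap k act (δ g)`):
    (∀ c : C, act (δ (1 : G)) (Pmap k act (δ (1 : G)) c) = c) ∧
    -- (b) `θ_{h⁻¹} (P_{g⁻¹} (P_h c)) = P_{(gh)⁻¹} (θ_{h⁻¹} (P_h c))`: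
    (∀ (g h : G) (c : C),
      act (δ h⁻¹) (Pmap k act (δ h⁻¹) (Pmap k act (δ g) (Pmap k act (δ h⁻¹) c))) =
      Pmap k act (δ (g * h)) (act (δ h⁻¹) (Pmap k act (δ h⁻¹) (Pmap k act (δ h⁻¹) c)))) ∧
    -- (c) `θ_g (θ_h (P_{h⁻¹} (P_{(gh)⁻¹} c))) = θ_{gh} (P_{h⁻¹} (P_{(gh)⁻¹} c))`:
    (∀ (g h : G) (c : C),
      act (δ g) (Pmap k act (δ g)
        (act (δ h) (Pmap k act (δ h) (Pmap k act (δ h) (Pmap k act (δ (g * h)) c))))) =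
      act (δ (g * h)) (Pmap k act (δ (g * h))
        (Pmap k act (δ h) (Pmap k act (δ (g * h)) c)))) := by
  have act_act (g h : G) (c : C) :
      act (δ g) (act (δ h) c) = act (δ (g * h)) (Pmap k act (δ h) c) := by
    rw [map_mul, hact.act_act_of_comul_eq _ (hcomul h)]
  have act_one (c : C) : act (δ 1) c = c := by rw [map_one, hact.plhmc2]
  have act_P (g : G) (c : C) : act (δ g) (Pmap k act (δ g) c) = act (δ g) c := by
    simpa [hact.plhmc2] using (act_act 1 g c).symm
  have P_eq (g : G) (c : C) : Pmap k act (δ g) c = act (δ g⁻¹) (act (δ g) c) := by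
    rw [act_act, inv_mul_cancel, act_one]
  refine ⟨fun c => by rw [act_P, act_one], fun g h c => ?_, fun g h c => ?_⟩
  · simp only [act_P]
    rw [P_eq (g * h), act_act (g * h), mul_inv_cancel_right, act_act, mul_inv_rev,
      inv_mul_cancel_right]
  · simp only [act_P, act_act g h]
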